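/- Let A be a Lie algebroid and (U, K = U°, Δ) data defining an LA-Dirac structure on A (conditions (1)–(5) of the decomposition theorem). Then the quotient bundle C = (U ⊕ A ⊕ T*M)/graph(−(ρ,ρᵗ)|_{U°}: U° → U), with anchor c(u⊕τ) = pr_TM(u) + ρ(pr_A τ), pairing ⟨⟨u1⊕τ1, u2⊕τ2⟩⟩ = ⟨u1,τ2⟩ + ⟨u2,τ1⟩ + ⟨τ1,(ρ,ρᵗ)τ2⟩, and bracket [u1⊕τ1, u2⊕τ2] = (⟦u1,u2⟧_Δ + ∇^bas_{τ1}u2 − ∇^bas_{τ2}u1) ⊕ ([τ1,τ2]_d + Δ_{u1}τ2 − Δ_{u2}τ1 + (0, d⟨τ1,u2⟩)), is a Courant algebroid over M. -/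

import Mathlib

/-! Algebraic model of differential geometry: the "functions" form a commutative
ℝ-algebra `R`, vector fields are `ℝ`-derivations of `R`, and one-forms are the
`R`-dual of the module of vector fields. -/

variable (R : Type*) [CommRing R] [Algebra ℝ R]

/-- Vector fields on the "manifold" with function algebra `R`. -/
abbrev VF := Derivation ℝ R R

/-- One-forms: the `R`-dual of the module of vector fields. -/
abbrev OneForm := VF R →ₗ[R] R

variable {R}

lemma vf_bracket_smul (X Y : VF R) (f : R) :
    ⁅X, f • Y⁆ = f • ⁅X, Y⁆ + (X f) • Y := by
  ext a
  simp only [Derivation.commutator_apply, Derivation.smul_apply, smul_eq_mul,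
    Derivation.leibniz, Derivation.add_apply]
  ring

/-- The differential of a function, as a one-form. -/
noncomputable def dF (f : R) : OneForm R where
  toFun X := X f
  map_add' X Y := rfl
  map_smul' r X := rfl

/-- The Lie derivative of a one-form along a vector field. -/
noncomputable def lieD (X : VF R) (θ : OneForm R) : OneForm R where
  toFun Y := X (θ Y) - θ ⁅X, Y⁆
  map_add' Y Z := by simp only [map_add, lie_add]; ring
  map_smul' f Y := by
    simp only [map_smul, smul_eq_mul, vf_bracket_smul, map_add, Derivation.leibniz,
      RingHom.id_apply]
    ring

/-- The interior product `ι_Y (dθ)` of the exterior differential of a one-form. -/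
noncomputable def iotaD (Y : VF R) (θ : OneForm R) : OneForm R where
  toFun X := Y (θ X) - X (θ Y) - θ ⁅Y, X⁆
  map_add' X Z := by simp only [map_add, lie_add, Derivation.add_apply]; ring
  map_smul' f X := by
    simp only [map_smul, smul_eq_mul, vf_bracket_smul, map_add, Derivation.leibniz,
      Derivation.smul_apply, RingHom.id_apply]
    ring

/-- The Courant–Dorfman bracket on sections of `TM ⊕ T*M`. -/
noncomputable def cbracket (e₁ e₂ : VF R × OneForm R) : VF R × OneForm R :=
  (⁅e₁.1, e₂.1⁆, lieD e₁.1 e₂.2 - iotaD e₂.1 e₁.2)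

/-- The canonical symmetric pairing on sections of `TM ⊕ T*M`. -/
noncomputable def cpair (e₁ e₂ : VF R × OneForm R) : R := e₁.2 e₂.1 + e₂.2 e₁.1

/-- A Lie algebroid (in the algebraic section model): an `R`-module `A` with a Lie
bracket on sections and an anchor `ρ : A → TM` satisfying the Leibniz rule and
preserving brackets. -/
structure LieAlgebroid (R : Type*) [CommRing R] [Algebra ℝ R]
    (A : Type*) [AddCommGroup A] [Module R A] where
  bracket : A → A → A
  bracket_add_left : ∀ a b c, bracket (a + b) c = bracket a c + bracket b c
  bracket_add_right : ∀ a b c, bracket a (b + c) = bracket a b + bracket a c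
  skew : ∀ a b, bracket a b = - bracket b a
  jacobi : ∀ a b c,
    bracket a (bracket b c) = bracket (bracket a b) c + bracket b (bracket a c)
  anchor : A →ₗ[R] VF R
  leibniz : ∀ a (f : R) b, bracket a (f • b) = f • bracket a b + (anchor a f) • b
  anchor_bracket : ∀ a b, anchor (bracket a b) = ⁅anchor a, anchor b⁆

variable {A : Type*} [AddCommGroup A] [Module R A]

/-- The pairing of the degenerate Courant algebroid `A ⊕ T*M`:
`⟨(a₁,θ₁),(a₂,θ₂)⟩_d = θ₂(ρ a₁) + θ₁(ρ a₂)`. -/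
noncomputable def dpair (L : LieAlgebroid R A) (τ₁ τ₂ : A × OneForm R) : R :=
  τ₂.2 (L.anchor τ₁.1) + τ₁.2 (L.anchor τ₂.1)

/-- The bracket of the degenerate Courant algebroid `A ⊕ T*M`:
`[(a₁,θ₁),(a₂,θ₂)]_d = ([a₁,a₂], L_{ρ a₁} θ₂ − ι_{ρ a₂} dθ₁)`. -/
noncomputable def dbracket (L : LieAlgebroid R A) (τ₁ τ₂ : A × OneForm R) :
    A × OneForm R :=
  (L.bracket τ₁.1 τ₂.1, lieD (L.anchor τ₁.1) τ₂.2 - iotaD (L.anchor τ₂.1) τ₁.2)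

/-- The canonical pairing between `TM ⊕ A*` and `A ⊕ T*M`: `⟨(X,α),(a,θ)⟩ = α(a) + θ(X)`. -/
noncomputable def mixPair (ν : VF R × (A →ₗ[R] R)) (τ : A × OneForm R) : R :=
  ν.2 τ.1 + τ.2 ν.1

/-- A Dorfman connection `Δ : Γ(TM ⊕ A*) × Γ(A ⊕ T*M) → Γ(A ⊕ T*M)` relative to the
anchor `pr_TM` and the canonical pairing. -/
structure DorfmanConn (R : Type*) [CommRing R] [Algebra ℝ R]
    (A : Type*) [AddCommGroup A] [Module R A] where
  conn : (VF R × (A →ₗ[R] R)) → (A × OneForm R) → (A × OneForm R)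
  add_left : ∀ ν₁ ν₂ τ, conn (ν₁ + ν₂) τ = conn ν₁ τ + conn ν₂ τ
  add_right : ∀ ν τ₁ τ₂, conn ν (τ₁ + τ₂) = conn ν τ₁ + conn ν τ₂
  /-- `Δ_ν` is a derivation over `pr_TM(ν)`. -/
  leibniz : ∀ ν (f : R) τ, conn ν (f • τ) = f • conn ν τ + (ν.1 f) • τ
  /-- `Δ_{fν} τ = f Δ_ν τ + ⟨ν,τ⟩ · (0, df)`. -/
  smul_left : ∀ (f : R) ν τ,
    conn (f • ν) τ = f • conn ν τ + (mixPair ν τ) • ((0 : A), dF f)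
  /-- `Δ_ν (0, df) = (0, d(pr_TM(ν) f))`. -/
  conn_d : ∀ ν (f : R), conn ν ((0 : A), dF f) = ((0 : A), dF (ν.1 f))


/-- The map `(ρ, ρᵗ) : A ⊕ T*M → TM ⊕ A*`, `(a,θ) ↦ (ρ(a), θ ∘ ρ)`. -/
noncomputable def rr (L : LieAlgebroid R A) (τ : A × OneForm R) :
    VF R × (A →ₗ[R] R) :=
  (L.anchor τ.1, τ.2 ∘ₗ L.anchor)


/-- `Ω_ν a = Δ_ν (a,0) − (0, d⟨ν,(a,0)⟩)`. -/
noncomputable def Omga (Dc : DorfmanConn R A) (ν : VF R × (A →ₗ[R] R)) (a : A) :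
    A × OneForm R :=
  Dc.conn ν (a, 0) - ((0 : A), dF (ν.2 a))


/-- The Lie derivative `L_a` on `Γ(A ⊕ T*M)`: `L_a (a',θ) = ([a,a'], L_{ρ(a)} θ)`. -/
noncomputable def lieTau (L : LieAlgebroid R A) (a : A) (τ : A × OneForm R) :
    A × OneForm R :=
  (L.bracket a τ.1, lieD (L.anchor a) τ.2)


/-- The Lie algebroid Lie derivative of a section of `A*` along a section of `A`. -/
noncomputable def lieADual (L : LieAlgebroid R A) (a : A) (α : A →ₗ[R] R) :
    A →ₗ[R] R where
  toFun b := L.anchor a (α b) - α (L.bracket a b)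
  map_add' b c := by simp only [map_add, L.bracket_add_right]; ring
  map_smul' f b := by
    simp only [map_smul, smul_eq_mul, L.leibniz, map_add, Derivation.leibniz,
      RingHom.id_apply]
    ring


/-- The Lie derivative `L_a` on `Γ(TM ⊕ A*)`: `L_a (X,α) = ([ρ(a),X], L_a α)`. -/
noncomputable def lieNu (L : LieAlgebroid R A) (a : A) (ν : VF R × (A →ₗ[R] R)) :
    VF R × (A →ₗ[R] R) :=
  (⁅L.anchor a, ν.1⁆, lieADual L a ν.2)


/-- The basic connection `∇^bas : Γ(A) × Γ(TM ⊕ A*) → Γ(TM ⊕ A*)`,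
`∇^bas_a ν = (ρ,ρᵗ)(Ω_ν a) + L_a ν`. -/
noncomputable def nbasA (L : LieAlgebroid R A) (Dc : DorfmanConn R A) (a : A)
    (ν : VF R × (A →ₗ[R] R)) : VF R × (A →ₗ[R] R) :=
  rr L (Omga Dc ν a) + lieNu L a ν


/-- The basic curvature `R^bas_Δ ∈ Ω²(A, Hom(TM ⊕ A*, A ⊕ T*M))`. -/
noncomputable def Rbas (L : LieAlgebroid R A) (Dc : DorfmanConn R A) (a₁ a₂ : A)
    (ν : VF R × (A →ₗ[R] R)) : A × OneForm R :=
  - Omga Dc ν (L.bracket a₁ a₂) + lieTau L a₁ (Omga Dc ν a₂)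
    - lieTau L a₂ (Omga Dc ν a₁)
    + Omga Dc (nbasA L Dc a₂ ν) a₁ - Omga Dc (nbasA L Dc a₁ ν) a₂

section Statement17

variable (R : Type*) [CommRing R] [Algebra ℝ R]
variable {A : Type*} [AddCommGroup A] [Module R A]

variable (A) in
/-- Elements of `U ⊕ (A ⊕ T*M)`, whose quotient by the graph of
`−(ρ,ρᵗ)|_{U°}` is the Courant algebroid `C`. -/
abbrev WSp := (VF R × (A →ₗ[R] R)) × (A × OneForm R)

variable {R}

/-- The graph of `−(ρ,ρᵗ)|_{U°} : U° → U`, by which one quotients. -/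
noncomputable def graphG (L : LieAlgebroid R A) (U : Submodule R (VF R × (A →ₗ[R] R))) :
    Set (WSp R A) :=
  {p | p.1 = - rr L p.2 ∧ ∀ u ∈ U, mixPair u p.2 = 0}

/-- The bracket of the Courant algebroid `C`:
`[u₁⊕τ₁, u₂⊕τ₂] = (⟦u₁,u₂⟧_Δ + ∇^bas_{τ₁}u₂ − ∇^bas_{τ₂}u₁) ⊕
([τ₁,τ₂]_d + Δ_{u₁}τ₂ − Δ_{u₂}τ₁ + (0, d⟨τ₁,u₂⟩))`. -/
noncomputable def Cbr (L : LieAlgebroid R A) (Dc : DorfmanConn R A)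
    (db : (VF R × (A →ₗ[R] R)) → (VF R × (A →ₗ[R] R)) → (VF R × (A →ₗ[R] R)))
    (e₁ e₂ : WSp R A) : WSp R A :=
  (db e₁.1 e₂.1 + nbasA L Dc e₁.2.1 e₂.1 - nbasA L Dc e₂.2.1 e₁.1,
    dbracket L e₁.2 e₂.2 + Dc.conn e₁.1 e₂.2 - Dc.conn e₂.1 e₁.2
      + ((0 : A), dF (mixPair e₂.1 e₁.2)))

/-- The pairing of the Courant algebroid `C`:
`⟨⟨u₁⊕τ₁, u₂⊕τ₂⟩⟩ = ⟨u₁,τ₂⟩ + ⟨u₂,τ₁⟩ + ⟨τ₁,(ρ,ρᵗ)τ₂⟩`. -/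
noncomputable def Cpair (L : LieAlgebroid R A) (e₁ e₂ : WSp R A) : R :=
  mixPair e₁.1 e₂.2 + mixPair e₂.1 e₁.2 + mixPair (rr L e₂.2) e₁.2

/-- The hypotheses bundled. -/
structure LADHyp (L : LieAlgebroid R A) (Dc : DorfmanConn R A)
    (U : Submodule R (VF R × (A →ₗ[R] R)))
    (db : (VF R × (A →ₗ[R] R)) → (VF R × (A →ₗ[R] R)) → (VF R × (A →ₗ[R] R))) : Prop where
  hdb : ∀ ν₁ ν₂ τ,
      mixPair (db ν₁ ν₂) τ = ν₁.1 (mixPair ν₂ τ) - mixPair ν₂ (Dc.conn ν₁ τ)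
  anc : ∀ ν₁ ν₂, (db ν₁ ν₂).1 = ⁅ν₁.1, ν₂.1⁆
  hKU : ∀ τ : A × OneForm R, (∀ u ∈ U, mixPair u τ = 0) → rr L τ ∈ U
  closed : ∀ u ∈ U, ∀ u' ∈ U, db u u' ∈ U
  skew : ∀ u ∈ U, ∀ u' ∈ U, db u u' = - db u' u
  jacobi : ∀ u ∈ U, ∀ u' ∈ U, ∀ u'' ∈ U,
      db u (db u' u'') = db (db u u') u'' + db u' (db u u'')
  nbas : ∀ (a : A), ∀ u ∈ U, nbasA L Dc a u ∈ U
  rbas : ∀ (a b : A), ∀ u ∈ U, ∀ u' ∈ U, mixPair u' (Rbas L Dc a b u) = 0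

lemma mixPair_add_left (x y : VF R × (A →ₗ[R] R)) (t : A × OneForm R) :
    mixPair (x + y) t = mixPair x t + mixPair y t := by
  simp [mixPair]; ring
lemma mixPair_sub_left (x y : VF R × (A →ₗ[R] R)) (t : A × OneForm R) :
    mixPair (x - y) t = mixPair x t - mixPair y t := by
  simp [mixPair]; ring
lemma mixPair_neg_left (x : VF R × (A →ₗ[R] R)) (t : A × OneForm R) :
    mixPair (-x) t = - mixPair x t := by
  simp [mixPair]; ring
lemma mixPair_zero_left (t : A × OneForm R) :
    mixPair (0 : VF R × (A →ₗ[R] R)) t = 0 := by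
  simp [mixPair]
lemma mixPair_add_right (x : VF R × (A →ₗ[R] R)) (s t : A × OneForm R) :
    mixPair x (s + t) = mixPair x s + mixPair x t := by
  simp [mixPair]; ring
lemma mixPair_sub_right (x : VF R × (A →ₗ[R] R)) (s t : A × OneForm R) :
    mixPair x (s - t) = mixPair x s - mixPair x t := by
  simp [mixPair]; ring
lemma mixPair_neg_right (x : VF R × (A →ₗ[R] R)) (t : A × OneForm R) :
    mixPair x (-t) = - mixPair x t := by
  simp [mixPair]; ring
lemma mixPair_zero_right (x : VF R × (A →ₗ[R] R)) :
    mixPair x (0 : A × OneForm R) = 0 := by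
  simp [mixPair]

lemma mixPair_ext {x y : VF R × (A →ₗ[R] R)} (h : ∀ t, mixPair x t = mixPair y t) : x = y := by
  refine Prod.ext ?_ ?_
  · ext f
    simpa [mixPair, dF] using h (0, dF f)
  · ext a
    simpa [mixPair] using h (a, 0)

@[simp] lemma dF_app (f : R) (X : VF R) : dF f X = X f := rfl
@[simp] lemma lieD_app (X Y : VF R) (θ : OneForm R) :
    lieD X θ Y = X (θ Y) - θ ⁅X, Y⁆ := rfl
@[simp] lemma iotaD_app (Y X : VF R) (θ : OneForm R) :
    iotaD Y θ X = Y (θ X) - X (θ Y) - θ ⁅Y, X⁆ := rfl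
@[simp] lemma lieADual_app (L : LieAlgebroid R A) (a b : A) (α : A →ₗ[R] R) :
    lieADual L a α b = L.anchor a (α b) - α (L.bracket a b) := rfl

lemma dF_add (f g : R) : dF (f + g) = dF f + dF g := by ext X; simp
lemma dF_zero : dF (0 : R) = 0 := by ext X; simp
lemma dF_neg (f : R) : dF (-f) = -dF f := by ext X; simp

lemma rr_symm (L : LieAlgebroid R A) (s t : A × OneForm R) :
    mixPair (rr L s) t = mixPair (rr L t) s := by
  simp [mixPair, rr]; ring
lemma rr_add (L : LieAlgebroid R A) (s t : A × OneForm R) :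
    rr L (s + t) = rr L s + rr L t := by
  refine mixPair_ext fun x => ?_
  rw [mixPair_add_left, rr_symm, mixPair_add_right, rr_symm, rr_symm L x t]
lemma rr_neg (L : LieAlgebroid R A) (s : A × OneForm R) :
    rr L (-s) = - rr L s := by
  refine mixPair_ext fun x => ?_
  rw [mixPair_neg_left, rr_symm, mixPair_neg_right, rr_symm]
lemma rr_zero (L : LieAlgebroid R A) : rr L 0 = 0 := by
  refine mixPair_ext fun x => ?_
  rw [mixPair_zero_left, rr_symm, mixPair_zero_right]

lemma Lbr_zero_left (L : LieAlgebroid R A) (a : A) : L.bracket 0 a = 0 := by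
  have := L.bracket_add_left 0 0 a; simpa using this
lemma Lbr_zero_right (L : LieAlgebroid R A) (a : A) : L.bracket a 0 = 0 := by
  have := L.bracket_add_right a 0 0; simpa using this

/-- pairing of the basic connection -/
lemma nbas_pair (L : LieAlgebroid R A) (Dc : DorfmanConn R A) (a : A)
    (ν : VF R × (A →ₗ[R] R)) (t : A × OneForm R) :
    mixPair (nbasA L Dc a ν) t = mixPair (rr L t) (Dc.conn ν (a, 0))
      - L.anchor t.1 (ν.2 a) + t.2 ⁅L.anchor a, ν.1⁆ + L.anchor a (ν.2 t.1)
      - ν.2 (L.bracket a t.1) := by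
  unfold nbasA Omga
  rw [mixPair_add_left, rr_symm, mixPair_sub_right]
  simp [mixPair, lieNu, rr]; ring

lemma nbas_add_left (L : LieAlgebroid R A) (Dc : DorfmanConn R A) (a b : A)
    (ν : VF R × (A →ₗ[R] R)) : nbasA L Dc (a + b) ν = nbasA L Dc a ν + nbasA L Dc b ν := by
  refine mixPair_ext fun t => ?_
  have : ((a + b, 0) : A × OneForm R) = (a, 0) + (b, 0) := by simp
  simp only [nbas_pair, mixPair_add_left, this, Dc.add_right, mixPair_add_right, map_add,
    add_lie, L.bracket_add_left, Derivation.add_apply]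
  ring

lemma nbas_add_right (L : LieAlgebroid R A) (Dc : DorfmanConn R A) (a : A)
    (ν μ : VF R × (A →ₗ[R] R)) : nbasA L Dc a (ν + μ) = nbasA L Dc a ν + nbasA L Dc a μ := by
  refine mixPair_ext fun t => ?_
  simp only [nbas_pair, mixPair_add_left, Dc.add_left, mixPair_add_right, map_add,
    lie_add, Derivation.add_apply, Prod.fst_add, Prod.snd_add, LinearMap.add_apply]
  ring

lemma dbr_add_left (L : LieAlgebroid R A) (s t r : A × OneForm R) :
    dbracket L (s + t) r = dbracket L s r + dbracket L t r := by
  refine Prod.ext ?_ ?_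
  · simp [dbracket, L.bracket_add_left]
  · ext X; simp [dbracket]; ring
lemma dbr_add_right (L : LieAlgebroid R A) (s t r : A × OneForm R) :
    dbracket L r (s + t) = dbracket L r s + dbracket L r t := by
  refine Prod.ext ?_ ?_
  · simp [dbracket, L.bracket_add_right]
  · ext X; simp [dbracket]; ring

lemma dbr_jacobi (L : LieAlgebroid R A) (r s t : A × OneForm R) :
    dbracket L r (dbracket L s t) - dbracket L (dbracket L r s) t
      - dbracket L s (dbracket L r t) = 0 := by
  refine Prod.ext ?_ ?_
  · simp only [dbracket, Prod.fst_sub, Prod.fst_zero]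
    rw [L.jacobi r.1 s.1 t.1]; abel
  · ext X
    simp only [dbracket, Prod.snd_sub, Prod.snd_zero, LinearMap.sub_apply, lieD_app, iotaD_app,
      L.anchor_bracket, LinearMap.zero_apply, lie_lie, map_sub, Derivation.commutator_apply]
    ring

namespace LADHyp

variable {L : LieAlgebroid R A} {Dc : DorfmanConn R A}
    {U : Submodule R (VF R × (A →ₗ[R] R))}
    {db : (VF R × (A →ₗ[R] R)) → (VF R × (A →ₗ[R] R)) → (VF R × (A →ₗ[R] R))}

lemma conn_pair (h : LADHyp L Dc U db) (ν μ : VF R × (A →ₗ[R] R)) (t : A × OneForm R) :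
    mixPair ν (Dc.conn μ t) = μ.1 (mixPair ν t) - (db μ ν).2 t.1 - t.2 ⁅μ.1, ν.1⁆ := by
  have h1 := h.hdb μ ν t
  rw [mixPair, h.anc] at h1
  linear_combination h1

lemma db_add_left (h : LADHyp L Dc U db) (x y z : VF R × (A →ₗ[R] R)) :
    db (x + y) z = db x z + db y z := by
  refine mixPair_ext fun t => ?_
  simp only [mixPair_add_left, h.hdb, Dc.add_left, mixPair_add_right, Prod.fst_add,
    Derivation.add_apply]
  ring
lemma db_add_right (h : LADHyp L Dc U db) (x y z : VF R × (A →ₗ[R] R)) :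
    db z (x + y) = db z x + db z y := by
  refine mixPair_ext fun t => ?_
  simp only [mixPair_add_left, h.hdb, map_add]
  ring

lemma br_add_left (h : LADHyp L Dc U db) (x y z : (VF R × (A →ₗ[R] R)) × (A × OneForm R)) :
    Cbr L Dc db (x + y) z = Cbr L Dc db x z + Cbr L Dc db y z := by
  unfold Cbr
  refine Prod.ext ?_ ?_
  · simp only [Prod.fst_add, Prod.snd_add, h.db_add_left, nbas_add_left, nbas_add_right]
    abel
  · have e (f g : R) : (((0 : A), dF (f + g)) : A × OneForm R) = (0, dF f) + (0, dF g) := by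
      simp [dF_add]
    simp only [Prod.fst_add, Prod.snd_add, Dc.add_left, Dc.add_right, dbr_add_left,
      mixPair_add_right, e]
    abel
lemma br_add_right (h : LADHyp L Dc U db) (x y z : (VF R × (A →ₗ[R] R)) × (A × OneForm R)) :
    Cbr L Dc db z (x + y) = Cbr L Dc db z x + Cbr L Dc db z y := by
  unfold Cbr
  refine Prod.ext ?_ ?_
  · simp only [Prod.fst_add, Prod.snd_add, h.db_add_right, nbas_add_left, nbas_add_right]
    abel
  · have e (f g : R) : (((0 : A), dF (f + g)) : A × OneForm R) = (0, dF f) + (0, dF g) := by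
      simp [dF_add]
    simp only [Prod.fst_add, Prod.snd_add, Dc.add_left, Dc.add_right, dbr_add_right,
      mixPair_add_left, e]
    abel

lemma br_mem (h : LADHyp L Dc U db) {x y : (VF R × (A →ₗ[R] R)) × (A × OneForm R)}
    (hx : x.1 ∈ U) (hy : y.1 ∈ U) : (Cbr L Dc db x y).1 ∈ U :=
  U.sub_mem (U.add_mem (h.closed _ hx _ hy) (h.nbas _ _ hy)) (h.nbas _ _ hx)

end LADHyp

lemma Cpair_symm (L : LieAlgebroid R A) (x y : WSp R A) : Cpair L x y = Cpair L y x := by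
  unfold Cpair; rw [rr_symm]; ring
lemma Cpair_add_left (L : LieAlgebroid R A) (x y z : WSp R A) :
    Cpair L (x + y) z = Cpair L x z + Cpair L y z := by
  simp only [Cpair, Prod.fst_add, Prod.snd_add, mixPair_add_left, mixPair_add_right]; ring
lemma Cpair_neg_left (L : LieAlgebroid R A) (x z : WSp R A) :
    Cpair L (-x) z = - Cpair L x z := by
  simp only [Cpair, Prod.fst_neg, Prod.snd_neg, mixPair_neg_left, mixPair_neg_right]; ring
lemma Cpair_sub_left (L : LieAlgebroid R A) (x y z : WSp R A) :
    Cpair L (x - y) z = Cpair L x z - Cpair L y z := by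
  rw [sub_eq_add_neg, Cpair_add_left, Cpair_neg_left]; ring
lemma Cpair_add_right (L : LieAlgebroid R A) (x y z : WSp R A) :
    Cpair L z (x + y) = Cpair L z x + Cpair L z y := by
  rw [Cpair_symm, Cpair_add_left, Cpair_symm L x, Cpair_symm L y]

lemma Cpair_graph (L : LieAlgebroid R A) (U : Submodule R (VF R × (A →ₗ[R] R)))
    {g e : WSp R A} (hg : g ∈ graphG L U) (he : e.1 ∈ U) : Cpair L g e = 0 := by
  obtain ⟨h1, h2⟩ := hg
  rw [Cpair, h1, mixPair_neg_left, h2 _ he, rr_symm]; ring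

lemma Cpair_nondeg (L : LieAlgebroid R A) (U : Submodule R (VF R × (A →ₗ[R] R)))
    {e : WSp R A} (h : ∀ e' : WSp R A, e'.1 ∈ U → Cpair L e e' = 0) : e ∈ graphG L U := by
  refine ⟨mixPair_ext fun t => ?_, fun u hu => ?_⟩
  · have := h (0, t) U.zero_mem
    simp only [Cpair, mixPair_zero_left] at this
    rw [mixPair_neg_left, rr_symm]
    linear_combination this
  · have := h (u, 0) hu
    simpa only [Cpair, mixPair_zero_right, rr_zero, mixPair_zero_left, zero_add, add_zero] using this

lemma graph_anchor (L : LieAlgebroid R A) (U : Submodule R (VF R × (A →ₗ[R] R)))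
    {g : WSp R A} (hg : g ∈ graphG L U) : g.1.1 + L.anchor g.2.1 = 0 := by
  rw [hg.1]; simp [rr]

/-- The operator `D`. -/
noncomputable def Dop (f : R) : WSp R A := ((0, 0), ((0 : A), dF f))

lemma Dop_add (f g : R) : (Dop (f + g) : WSp R A) = Dop f + Dop g := by
  simp [Dop, dF_add]

/-- The anchor of `C`. -/
noncomputable def Canc (L : LieAlgebroid R A) (e : WSp R A) : VF R := e.1.1 + L.anchor e.2.1

lemma Cpair_Dop (L : LieAlgebroid R A) (f : R) (e : WSp R A) :
    Cpair L (Dop f) e = Canc L e f := by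
  simp [Cpair, Dop, Canc, mixPair, rr]

namespace LADHyp

variable {L : LieAlgebroid R A} {Dc : DorfmanConn R A}
    {U : Submodule R (VF R × (A →ₗ[R] R))}
    {db : (VF R × (A →ₗ[R] R)) → (VF R × (A →ₗ[R] R)) → (VF R × (A →ₗ[R] R))}

lemma ax3 (h : LADHyp L Dc U db) {x y : WSp R A} (hx : x.1 ∈ U) (hy : y.1 ∈ U) :
    Cbr L Dc db x y + Cbr L Dc db y x = Dop (Cpair L x y) := by
  refine Prod.ext ?_ ?_
  · simp only [Cbr, Prod.fst_add]
    rw [h.skew _ hx _ hy]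
    change _ = 0
    abel
  · refine Prod.ext ?_ ?_
    · simp only [Cbr, Dop, Prod.snd_add, Prod.fst_add, Prod.fst_sub, dbracket, add_zero]
      rw [L.skew]; abel
    · ext X
      simp only [Cbr, Dop, Prod.snd_add, Prod.snd_sub, dbracket, Cpair, LinearMap.add_apply,
        LinearMap.sub_apply, lieD_app, iotaD_app, dF_app, mixPair, rr, map_add,
        LinearMap.comp_apply]
      ring

lemma ax2 (h : LADHyp L Dc U db) {x y z : WSp R A} (hy : y.1 ∈ U) (hz : z.1 ∈ U) :
    Canc L x (Cpair L y z) = Cpair L (Cbr L Dc db x y) z + Cpair L y (Cbr L Dc db x z) := by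
  rw [Cpair_symm L y (Cbr L Dc db x z)]
  have hs := congrArg (fun q => q.2 x.2.1) (h.skew _ hy _ hz)
  simp only [Prod.snd_neg, LinearMap.neg_apply] at hs
  simp only [Cpair, Cbr, mixPair_add_left, mixPair_sub_left, mixPair_add_right, mixPair_sub_right,
    h.conn_pair, nbas_pair, Canc]
  simp only [mixPair, h.anc, rr, dbracket, map_add, map_sub, Derivation.add_apply, lieD_app,
    iotaD_app, dF_app, LinearMap.add_apply, LinearMap.sub_apply, LinearMap.comp_apply,
    Derivation.commutator_apply, L.anchor_bracket, map_zero, LinearMap.zero_apply]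
  have hl (P : VF R) (a : A) : ⁅P, L.anchor a⁆ = -⁅L.anchor a, P⁆ := (lie_skew _ _).symm
  simp only [hl x.1.1, hl y.1.1, hl z.1.1, hl (L.anchor z.2.1) y.2.1, L.skew z.2.1 y.2.1,
    (lie_skew z.1.1 y.1.1).symm, map_neg]
  linear_combination -hs

lemma anchor_br (h : LADHyp L Dc U db) (x y : WSp R A) :
    Canc L (Cbr L Dc db x y) = ⁅Canc L x, Canc L y⁆ := by
  have key (ν : VF R × (A →ₗ[R] R)) (t : A × OneForm R) :
      L.anchor (Dc.conn ν t).1 = L.anchor (Dc.conn ν (t.1, 0)).1 := by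
    have e : t = (t.1, 0) + (0, t.2) := by simp
    conv_lhs => rw [e, Dc.add_right, Prod.fst_add, map_add]
    rw [add_eq_left]
    ext f
    have := h.conn_pair (0, dF f ∘ₗ L.anchor) ν (0, t.2)
    simpa [mixPair] using this
  simp only [Canc, Cbr, nbasA, Omga, rr, lieNu, dbracket, Prod.fst_add, Prod.fst_sub, map_add, map_sub,
    h.anc, L.anchor_bracket, key _ x.2, key _ y.2, add_lie, lie_add, map_zero]
  rw [← lie_skew x.1.1 (L.anchor y.2.1)]
  abel

end LADHyp

namespace LADHyp

variable {L : LieAlgebroid R A} {Dc : DorfmanConn R A}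
    {U : Submodule R (VF R × (A →ₗ[R] R))}
    {db : (VF R × (A →ₗ[R] R)) → (VF R × (A →ₗ[R] R)) → (VF R × (A →ₗ[R] R))}

lemma Dop_mem (f : R) : (Dop f : WSp R A).1 ∈ U := U.zero_mem

lemma anchor_br_app (h : LADHyp L Dc U db) (x y : WSp R A) (f : R) :
    Canc L (Cbr L Dc db x y) f = Canc L x (Canc L y f) - Canc L y (Canc L x f) := by
  rw [h.anchor_br, Derivation.commutator_apply]

/-- the bracket with `D f` on the right -/
lemma br_Dop_right (h : LADHyp L Dc U db) {x y : WSp R A} (hx : x.1 ∈ U) (hy : y.1 ∈ U) (f : R) :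
    Cpair L (Cbr L Dc db x (Dop f)) y = Canc L y (Canc L x f) := by
  have h1 := h.ax2 (x := x) (y := Dop f) (z := y) (Dop_mem f) hy
  rw [Cpair_Dop, Cpair_Dop, h.anchor_br_app] at h1
  linear_combination -h1

lemma br_Dop_left (h : LADHyp L Dc U db) {x y : WSp R A} (hx : x.1 ∈ U) (hy : y.1 ∈ U) (f : R) :
    Cpair L (Cbr L Dc db (Dop f) x) y = 0 := by
  have h1 := congrArg (fun q => Cpair L q y) (h.ax3 (Dop_mem f) hx)
  simp only [Cpair_add_left, Cpair_Dop, h.br_Dop_right hx hy] at h1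
  linear_combination h1

/-- The Jacobiator, paired with a fourth element. -/
noncomputable def T (L : LieAlgebroid R A) (Dc : DorfmanConn R A)
    (db : (VF R × (A →ₗ[R] R)) → (VF R × (A →ₗ[R] R)) → (VF R × (A →ₗ[R] R)))
    (x y z w : WSp R A) : R :=
  Cpair L (Cbr L Dc db x (Cbr L Dc db y z) - Cbr L Dc db (Cbr L Dc db x y) z
        - Cbr L Dc db y (Cbr L Dc db x z)) w

lemma T_add1 (h : LADHyp L Dc U db) (x x' y z w : WSp R A) :
    T L Dc db (x + x') y z w = T L Dc db x y z w + T L Dc db x' y z w := by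
  simp only [T, h.br_add_left, h.br_add_right, Cpair_sub_left, Cpair_add_left]; ring
lemma T_add2 (h : LADHyp L Dc U db) (x y y' z w : WSp R A) :
    T L Dc db x (y + y') z w = T L Dc db x y z w + T L Dc db x y' z w := by
  simp only [T, h.br_add_left, h.br_add_right, Cpair_sub_left, Cpair_add_left]; ring
lemma T_add3 (h : LADHyp L Dc U db) (x y z z' w : WSp R A) :
    T L Dc db x y (z + z') w = T L Dc db x y z w + T L Dc db x y z' w := by
  simp only [T, h.br_add_right, Cpair_sub_left, Cpair_add_left]; ring
lemma T_add4 (x y z w w' : WSp R A) :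
    T L Dc db x y z (w + w') = T L Dc db x y z w + T L Dc db x y z w' := by
  simp only [T, Cpair_add_right]

lemma T_swap34 (h : LADHyp L Dc U db) {x y z w : WSp R A}
    (hx : x.1 ∈ U) (hy : y.1 ∈ U) (hz : z.1 ∈ U) (hw : w.1 ∈ U) :
    T L Dc db x y z w = - T L Dc db x y w z := by
  have a1 := h.ax2 (x := x) (h.br_mem hy hz) hw
  have a2 := h.ax2 (x := y) (h.br_mem hx hz) hw
  have a3 := h.ax2 (x := Cbr L Dc db x y) hz hw
  have b1 := h.ax2 (x := x) hz (h.br_mem hy hw)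
  have b2 := h.ax2 (x := y) hz (h.br_mem hx hw)
  have c1 := congrArg (Canc L x) (h.ax2 (x := y) hz hw)
  have c2 := congrArg (Canc L y) (h.ax2 (x := x) hz hw)
  rw [h.anchor_br_app] at a3
  rw [map_add] at c1 c2
  have s1 := Cpair_symm L z (Cbr L Dc db x (Cbr L Dc db y w))
  have s2 := Cpair_symm L z (Cbr L Dc db y (Cbr L Dc db x w))
  have s3 := Cpair_symm L z (Cbr L Dc db (Cbr L Dc db x y) w)
  simp only [T, Cpair_sub_left]
  rw [← s1, ← s2, ← s3]
  linear_combination -a1 + a2 + a3 - b1 + b2 - c1 + c2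

lemma T_swap12 (h : LADHyp L Dc U db) {x y z w : WSp R A}
    (hx : x.1 ∈ U) (hy : y.1 ∈ U) (hz : z.1 ∈ U) (hw : w.1 ∈ U) :
    T L Dc db x y z w = - T L Dc db y x z w := by
  have h1 := h.br_Dop_left hz hw (Cpair L x y)
  rw [← h.ax3 hx hy, h.br_add_left, Cpair_add_left] at h1
  simp only [T, Cpair_sub_left]
  linear_combination -h1

lemma T_swap23 (h : LADHyp L Dc U db) {x y z w : WSp R A}
    (hx : x.1 ∈ U) (hy : y.1 ∈ U) (hz : z.1 ∈ U) (hw : w.1 ∈ U) :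
    T L Dc db x y z w = - T L Dc db x z y w := by
  have h1 := h.br_Dop_right hx hw (Cpair L y z)
  rw [← h.ax3 hy hz, h.br_add_right, Cpair_add_left, h.ax2 hy hz, map_add] at h1
  have h2 := congrArg (fun q => Cpair L q w) (h.ax3 (h.br_mem hx hy) hz)
  have h3 := congrArg (fun q => Cpair L q w) (h.ax3 hy (h.br_mem hx hz))
  simp only [Cpair_add_left, Cpair_Dop] at h2 h3
  simp only [T, Cpair_sub_left]
  linear_combination h1 - h2 - h3

/-- inclusion of `U` -/
def iU (u : VF R × (A →ₗ[R] R)) : WSp R A := (u, 0)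
/-- inclusion of `A ⊕ T*M` -/
def iT (t : A × OneForm R) : WSp R A := (0, t)

lemma iT_mem (t : A × OneForm R) : (iT t : WSp R A).1 ∈ U := U.zero_mem

lemma nbas_zero_left (Dc : DorfmanConn R A) (u : VF R × (A →ₗ[R] R)) : nbasA L Dc 0 u = 0 := by
  have := nbas_add_left L Dc 0 0 u; simpa using this
lemma nbas_zero_right (Dc : DorfmanConn R A) (a : A) : nbasA L Dc a 0 = 0 := by
  have := nbas_add_right L Dc a 0 0; simpa using this
lemma conn_zero_left (Dc : DorfmanConn R A) (t : A × OneForm R) : Dc.conn 0 t = 0 := by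
  have := Dc.add_left 0 0 t; simpa using this
lemma conn_zero_right (Dc : DorfmanConn R A) (u : VF R × (A →ₗ[R] R)) : Dc.conn u 0 = 0 := by
  have := Dc.add_right u 0 0; simpa using this
lemma dbr_zero_left (t : A × OneForm R) : dbracket L 0 t = 0 := by
  have := dbr_add_left L 0 0 t; simpa using this
lemma dbr_zero_right (t : A × OneForm R) : dbracket L t 0 = 0 := by
  have := dbr_add_right L 0 0 t; simpa using this
lemma db_zero_left (h : LADHyp L Dc U db) (u : VF R × (A →ₗ[R] R)) : db 0 u = 0 := by
  have := h.db_add_left 0 0 u; simpa using this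
lemma db_zero_right (h : LADHyp L Dc U db) (u : VF R × (A →ₗ[R] R)) : db u 0 = 0 := by
  have := h.db_add_right 0 0 u; simpa using this

lemma br_uu (_h : LADHyp L Dc U db) (u v : VF R × (A →ₗ[R] R)) :
    Cbr L Dc db (iU u) (iU v) = iU (db u v) := by
  simp [Cbr, iU, nbas_zero_left, conn_zero_right, dbr_zero_left, mixPair_zero_right, dF_zero]
lemma br_tt (h : LADHyp L Dc U db) (s t : A × OneForm R) :
    Cbr L Dc db (iT s) (iT t) = iT (dbracket L s t) := by
  simp [Cbr, iT, nbas_zero_right, conn_zero_left, h.db_zero_left, mixPair_zero_left, dF_zero]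
lemma br_ut (h : LADHyp L Dc U db) (u : VF R × (A →ₗ[R] R)) (t : A × OneForm R) :
    Cbr L Dc db (iU u) (iT t) = (- nbasA L Dc t.1 u, Dc.conn u t) := by
  simp [Cbr, iT, iU, nbas_zero_right, conn_zero_left, h.db_zero_right, mixPair_zero_left, dF_zero,
    dbr_zero_left]

lemma T_uuu (h : LADHyp L Dc U db) {u v w : VF R × (A →ₗ[R] R)} (hu : u ∈ U) (hv : v ∈ U)
    (hw : w ∈ U) (e : WSp R A) : T L Dc db (iU u) (iU v) (iU w) e = 0 := by
  have : (iU (db u (db v w)) - iU (db (db u v) w) - iU (db v (db u w)) : WSp R A) = 0 := by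
    rw [h.jacobi u hu v hv w hw]; simp [iU]
  simp only [T, h.br_uu, this]
  simp [Cpair, mixPair_zero_left, mixPair_zero_right]

lemma T_ttt (h : LADHyp L Dc U db) (r s t : A × OneForm R) (e : WSp R A) :
    T L Dc db (iT r) (iT s) (iT t) e = 0 := by
  have : (iT (dbracket L r (dbracket L s t)) - iT (dbracket L (dbracket L r s) t)
      - iT (dbracket L s (dbracket L r t)) : WSp R A) = 0 := by
    have := dbr_jacobi L r s t
    refine Prod.ext ?_ this
    simp [iT]
  simp only [T, h.br_tt, this]
  simp [Cpair, mixPair_zero_left, mixPair_zero_right]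

/-- sections of `A` invisible to `A*` act trivially -/
lemma nbas_null (h : LADHyp L Dc U db) {c : A} (hc : ∀ α : A →ₗ[R] R, α c = 0)
    (u : VF R × (A →ₗ[R] R)) : nbasA L Dc c u = 0 := by
  have hr : L.anchor c = 0 := by
    ext f
    simpa using hc (dF f ∘ₗ L.anchor)
  have hb (α : A →ₗ[R] R) (b : A) : α (L.bracket c b) = 0 := by
    have h1 := hc (lieADual L b α)
    rw [lieADual_app, hc, map_zero] at h1
    rw [L.skew, map_neg]
    linear_combination h1
  refine mixPair_ext fun t => ?_
  rw [nbas_pair, h.conn_pair]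
  simp [hr, hb, hc, mixPair]

lemma conn_form_null (h : LADHyp L Dc U db) (u : VF R × (A →ₗ[R] R)) {t : A × OneForm R}
    (ht : ∀ α : A →ₗ[R] R, α t.1 = 0) (α : A →ₗ[R] R) : α (Dc.conn u t).1 = 0 := by
  have := h.conn_pair (0, α) u t
  simpa [mixPair, ht] using this

lemma T_form (h : LADHyp L Dc U db) (u v : VF R × (A →ₗ[R] R)) (θ : OneForm R)
    (t : A × OneForm R) : T L Dc db (iU u) (iU v) (iT (0, θ)) (iT t) = 0 := by
  have h0 : ∀ α : A →ₗ[R] R, α ((0, θ) : A × OneForm R).1 = 0 := fun α => map_zero α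
  have key (v : VF R × (A →ₗ[R] R)) {t : A × OneForm R} (ht : ∀ α : A →ₗ[R] R, α t.1 = 0) :
      Cbr L Dc db (iU v) (iT t) = iT (Dc.conn v t) := by
    rw [h.br_ut, h.nbas_null ht]; simp [iT]
  rw [T, key v h0, key u h0, key u (h.conn_form_null v h0), key v (h.conn_form_null u h0),
    h.br_uu, key _ h0]
  simp only [Cpair_sub_left]
  simp only [Cpair, iT, mixPair_zero_left, zero_add, h.conn_pair]
  have e (ν : VF R × (A →ₗ[R] R)) (s : A × OneForm R) (hs : ∀ α : A →ₗ[R] R, α s.1 = 0)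
      (X : VF R) : (Dc.conn ν s).2 X = ν.1 (s.2 X) - s.2 ⁅ν.1, X⁆ := by
    have := h.conn_pair (X, 0) ν s
    simpa [mixPair, hs] using this
  simp only [mixPair, h.conn_form_null _ h0, e _ _ h0, h.anc, map_zero, lie_lie, rr, map_sub,
    Derivation.commutator_apply, zero_add]
  ring

lemma T_aauu (h : LADHyp L Dc U db) (a b : A) {u v : VF R × (A →ₗ[R] R)} (hu : u ∈ U)
    (hv : v ∈ U) : T L Dc db (iT (a, 0)) (iT (b, 0)) (iU u) (iU v) = 0 := by
  have key := h.rbas a b u hu v hv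
  have e1 (a : A) (τ : A × OneForm R) : lieTau L a τ = dbracket L (a, 0) τ := by
    refine Prod.ext rfl ?_
    ext X; simp [lieTau, dbracket]
  have e2 : dbracket L ((a, 0) : A × OneForm R) (b, 0) = (L.bracket a b, 0) := by
    refine Prod.ext rfl ?_
    ext X; simp [dbracket]
  have b1 (a : A) (w : WSp R A) : Cbr L Dc db (iT (a, 0)) w =
      (nbasA L Dc a w.1, dbracket L (a, 0) w.2 - Omga Dc w.1 a) := by
    refine Prod.ext ?_ ?_
    · simp [Cbr, iT, h.db_zero_left, nbas_zero_right]
    · simp only [Cbr, iT, conn_zero_left, Omga, mixPair, LinearMap.zero_apply, add_zero]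
      abel
  simp only [T, h.br_tt, e2, b1]
  simp only [Rbas, e1] at key
  simp only [Cpair, iU, Prod.snd_sub, mixPair_zero_right, rr_zero, mixPair_zero_left,
    dbr_zero_right, zero_sub, mixPair_add_right, mixPair_sub_right, mixPair_neg_right] at key ⊢
  have n (s t : A × OneForm R) : dbracket L s (-t) = - dbracket L s t := by
    rw [eq_neg_iff_add_eq_zero, ← dbr_add_right, neg_add_cancel, dbr_zero_right]
  simp only [n, mixPair_neg_right]
  linear_combination -key

lemma T_uutt (h : LADHyp L Dc U db) {u v : VF R × (A →ₗ[R] R)} (hu : u ∈ U)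
    (hv : v ∈ U) (s t : A × OneForm R) : T L Dc db (iU u) (iU v) (iT s) (iT t) = 0 := by
  have es (s : A × OneForm R) : (iT s : WSp R A) = iT (s.1, 0) + iT (0, s.2) := by simp [iT]
  have hu' : (iU u : WSp R A).1 ∈ U := hu
  have hv' : (iU v : WSp R A).1 ∈ U := hv
  rw [es s, h.T_add3, h.T_form, add_zero, es t, T_add4,
    h.T_swap34 hu' hv' (iT_mem (s.1, 0)) (iT_mem (0, t.2)), h.T_form, neg_zero, add_zero,
    h.T_swap23 hu' hv' (iT_mem _) (iT_mem _), h.T_swap34 hu' (iT_mem _) hv' (iT_mem _),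
    h.T_swap12 hu' (iT_mem _) (iT_mem _) hv', h.T_swap23 (iT_mem _) hu' (iT_mem _) hv',
    h.T_aauu _ _ hu hv]
  simp

lemma T_zero (h : LADHyp L Dc U db) {x y z w : WSp R A}
    (hx : x.1 ∈ U) (hy : y.1 ∈ U) (hz : z.1 ∈ U) (hw : w.1 ∈ U) :
    T L Dc db x y z w = 0 := by
  have dec (e : WSp R A) : e = iU e.1 + iT e.2 := by simp [iT, iU]
  have m (e : WSp R A) (he : e.1 ∈ U) : (iU e.1 : WSp R A).1 ∈ U := he
  have hx' := m x hx
  have hy' := m y hy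
  have hz' := m z hz
  have hw' := m w hw
  have tx := iT_mem (U := U) x.2
  have ty := iT_mem (U := U) y.2
  have tz := iT_mem (U := U) z.2
  have tw := iT_mem (U := U) w.2
  rw [dec x, dec y, dec z, dec w]
  simp only [h.T_add1, h.T_add2, h.T_add3, T_add4, h.T_uuu hx hy hz, h.T_ttt]
  -- two `u` and two `τ`
  have u2 {a b : VF R × (A →ₗ[R] R)} (ha : a ∈ U) (hb : b ∈ U) (s t : A × OneForm R) :
      T L Dc db (iU a) (iU b) (iT s) (iT t) = 0 ∧ T L Dc db (iU a) (iT s) (iU b) (iT t) = 0 ∧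
      T L Dc db (iU a) (iT s) (iT t) (iU b) = 0 ∧ T L Dc db (iT s) (iU a) (iU b) (iT t) = 0 ∧
      T L Dc db (iT s) (iU a) (iT t) (iU b) = 0 ∧ T L Dc db (iT s) (iT t) (iU a) (iU b) = 0 := by
    have ha' : (iU a : WSp R A).1 ∈ U := ha
    have hb' : (iU b : WSp R A).1 ∈ U := hb
    have hs := iT_mem (U := U) s
    have ht := iT_mem (U := U) t
    have c1 := h.T_uutt ha hb s t
    have c2 : T L Dc db (iU a) (iT s) (iU b) (iT t) = 0 := by
      rw [h.T_swap23 ha' hs hb' ht, c1, neg_zero]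
    have c3 : T L Dc db (iU a) (iT s) (iT t) (iU b) = 0 := by
      rw [h.T_swap34 ha' hs ht hb', c2, neg_zero]
    have c4 : T L Dc db (iT s) (iU a) (iU b) (iT t) = 0 := by
      rw [h.T_swap12 hs ha' hb' ht, c2, neg_zero]
    have c5 : T L Dc db (iT s) (iU a) (iT t) (iU b) = 0 := by
      rw [h.T_swap34 hs ha' ht hb', c4, neg_zero]
    have c6 : T L Dc db (iT s) (iT t) (iU a) (iU b) = 0 := by
      rw [h.T_swap23 hs ht ha' hb', c5, neg_zero]
    exact ⟨c1, c2, c3, c4, c5, c6⟩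
  -- three `u`
  have u3c : T L Dc db (iU x.1) (iU y.1) (iT z.2) (iU w.1) = 0 := by
    rw [h.T_swap34 hx' hy' tz hw', h.T_uuu hx hy hw, neg_zero]
  have u3b : T L Dc db (iU x.1) (iT y.2) (iU z.1) (iU w.1) = 0 := by
    rw [h.T_swap23 hx' ty hz' hw', h.T_swap34 hx' hz' ty hw', h.T_uuu hx hz hw, neg_zero, neg_zero]
  have u3a : T L Dc db (iT x.2) (iU y.1) (iU z.1) (iU w.1) = 0 := by
    rw [h.T_swap12 tx hy' hz' hw', h.T_swap23 hy' tx hz' hw', h.T_swap34 hy' hz' tx hw',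
      h.T_uuu hy hz hw]
    simp
  -- three `τ`
  have t3c : T L Dc db (iT x.2) (iT y.2) (iU z.1) (iT w.2) = 0 := by
    rw [h.T_swap34 tx ty hz' tw, h.T_ttt, neg_zero]
  have t3b : T L Dc db (iT x.2) (iU y.1) (iT z.2) (iT w.2) = 0 := by
    rw [h.T_swap23 tx hy' tz tw, h.T_swap34 tx tz hy' tw, h.T_ttt, neg_zero, neg_zero]
  have t3a : T L Dc db (iU x.1) (iT y.2) (iT z.2) (iT w.2) = 0 := by
    rw [h.T_swap12 hx' ty tz tw, h.T_swap23 ty hx' tz tw, h.T_swap34 ty tz hx' tw, h.T_ttt]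
    simp
  simp only [u3a, u3b, u3c, t3a, t3b, t3c, (u2 hx hy _ _).1, (u2 hx hz _ _).2.1,
    (u2 hx hw _ _).2.2.1, (u2 hy hz _ _).2.2.2.1, (u2 hy hw _ _).2.2.2.2.1,
    (u2 hz hw _ _).2.2.2.2.2, add_zero]

lemma br_graph_right (h : LADHyp L Dc U db) {g e : WSp R A} (hg : g ∈ graphG L U)
    (he : e.1 ∈ U) : Cbr L Dc db e g ∈ graphG L U := by
  have hgU : g.1 ∈ U := by
    rw [hg.1]; exact U.neg_mem (h.hKU _ hg.2)
  refine Cpair_nondeg L U fun w hw => ?_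
  have h1 := h.ax2 (x := e) hgU hw
  rw [Cpair_graph L U hg hw, Cpair_graph L U hg (h.br_mem he hw), map_zero, add_zero] at h1
  exact h1.symm

lemma br_graph_left (h : LADHyp L Dc U db) {g e : WSp R A} (hg : g ∈ graphG L U)
    (he : e.1 ∈ U) : Cbr L Dc db g e ∈ graphG L U := by
  have hgU : g.1 ∈ U := by
    rw [hg.1]; exact U.neg_mem (h.hKU _ hg.2)
  refine Cpair_nondeg L U fun w hw => ?_
  have h1 := congrArg (fun q => Cpair L q w) (h.ax3 hgU he)
  simp only [Cpair_add_left, Cpair_graph L U (h.br_graph_right hg he) hw, Cpair_Dop,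
    Cpair_graph L U hg he, map_zero, add_zero] at h1
  exact h1

end LADHyp

/-- For an LA-Dirac triple `(U, K = U°, Δ)` on a Lie algebroid `A`,
the quotient `C = (U ⊕ A ⊕ T*M)/graph(−(ρ,ρᵗ)|_{U°})` with anchor
`c(u⊕τ) = pr_TM(u) + ρ(pr_A τ)`, the pairing `⟨⟨·,·⟩⟩` and the bracket above is a
Courant algebroid over `M`: the bracket and pairing descend to the quotient, the
bracket preserves the `U`-component, and axioms (1)–(3) and nondegeneracy hold
modulo the graph. -/
theorem quotient_is_courant_algebroid
    (L : LieAlgebroid R A) (Dc : DorfmanConn R A)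
    (U : Submodule R (VF R × (A →ₗ[R] R)))
    (db : (VF R × (A →ₗ[R] R)) → (VF R × (A →ₗ[R] R)) → (VF R × (A →ₗ[R] R)))
    (hdb : ∀ ν₁ ν₂ τ,
      mixPair (db ν₁ ν₂) τ = ν₁.1 (mixPair ν₂ τ) - mixPair ν₂ (Dc.conn ν₁ τ))
    (hdb_anchor : ∀ ν₁ ν₂, (db ν₁ ν₂).1 = ⁅ν₁.1, ν₂.1⁆)
    (hKU : ∀ τ : A × OneForm R, (∀ u ∈ U, mixPair u τ = 0) → rr L τ ∈ U)
    (hU_closed : ∀ u ∈ U, ∀ u' ∈ U, db u u' ∈ U)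
    (hU_skew : ∀ u ∈ U, ∀ u' ∈ U, db u u' = - db u' u)
    (hU_jacobi : ∀ u ∈ U, ∀ u' ∈ U, ∀ u'' ∈ U,
      db u (db u' u'') = db (db u u') u'' + db u' (db u u''))
    (hnbas : ∀ (a : A), ∀ u ∈ U, nbasA L Dc a u ∈ U)
    (hRbas : ∀ (a b : A), ∀ u ∈ U, ∀ u' ∈ U, mixPair u' (Rbas L Dc a b u) = 0) :
    -- the bracket descends to the quotient and its `U`-component stays in `U`:
    (∀ g ∈ graphG L U, ∀ e : WSp R A, e.1 ∈ U →
      Cbr L Dc db e g ∈ graphG L U ∧ Cbr L Dc db g e ∈ graphG L U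
        ∧ Cpair L g e = 0 ∧ g.1.1 + L.anchor g.2.1 = 0) ∧
    (∀ e₁ e₂ : WSp R A, e₁.1 ∈ U → e₂.1 ∈ U → (Cbr L Dc db e₁ e₂).1 ∈ U) ∧
    -- axiom (1): Jacobi identity modulo the graph:
    (∀ e₁ e₂ e₃ : WSp R A, e₁.1 ∈ U → e₂.1 ∈ U → e₃.1 ∈ U →
      Cbr L Dc db e₁ (Cbr L Dc db e₂ e₃) - Cbr L Dc db (Cbr L Dc db e₁ e₂) e₃
        - Cbr L Dc db e₂ (Cbr L Dc db e₁ e₃) ∈ graphG L U) ∧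
    -- axiom (2): invariance of the pairing (with anchor `c(u⊕τ) = pr_TM u + ρ(pr_A τ)`):
    (∀ e₁ e₂ e₃ : WSp R A, e₁.1 ∈ U → e₂.1 ∈ U → e₃.1 ∈ U →
      (e₁.1.1 + L.anchor e₁.2.1) (Cpair L e₂ e₃)
        = Cpair L (Cbr L Dc db e₁ e₂) e₃ + Cpair L e₂ (Cbr L Dc db e₁ e₃)) ∧
    -- axiom (3): symmetrized bracket is `D` of the pairing, modulo the graph:
    (∀ e₁ e₂ : WSp R A, e₁.1 ∈ U → e₂.1 ∈ U →
      Cbr L Dc db e₁ e₂ + Cbr L Dc db e₂ e₁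
        - ((0, 0), ((0 : A), dF (Cpair L e₁ e₂))) ∈ graphG L U) ∧
    -- nondegeneracy of the pairing on the quotient:
    (∀ e : WSp R A, e.1 ∈ U → (∀ e' : WSp R A, e'.1 ∈ U → Cpair L e e' = 0) →
      e ∈ graphG L U) := by
  have h : LADHyp L Dc U db :=
    ⟨hdb, hdb_anchor, hKU, hU_closed, hU_skew, hU_jacobi, hnbas, hRbas⟩
  refine ⟨fun g hg e he => ⟨h.br_graph_right hg he, h.br_graph_left hg he,
    Cpair_graph L U hg he, graph_anchor L U hg⟩, fun e₁ e₂ h₁ h₂ => h.br_mem h₁ h₂,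
    fun e₁ e₂ e₃ h₁ h₂ h₃ => Cpair_nondeg L U fun w hw => h.T_zero h₁ h₂ h₃ hw,
    fun e₁ e₂ e₃ _ h₂ h₃ => h.ax2 h₂ h₃, fun e₁ e₂ h₁ h₂ => ?_,
    fun e _ he => Cpair_nondeg L U he⟩
  rw [h.ax3 h₁ h₂]
  refine Cpair_nondeg L U fun w _ => ?_
  rw [Cpair_sub_left]
  exact sub_self _

end Statement17
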